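/- Let 𝒜 be a semiprime uniformly complete f-algebra with the weak factorization property and let p ∈ ℕ with p ≥ 2. Then the finite elements of the product algebra Π_p(𝒜) are exactly the elements of Π_p(𝒜) that are finite in 𝒜, i.e. Φ₁(Π_p(𝒜)) = Φ₁(𝒜) ∩ Π_p(𝒜). -/

import Mathlib

namespace FiniteElementsPaper

/-- Product of `p` factors `φ 0 * φ 1 * ⋯ * φ (p-1)` in a (possibly non-unital)
multiplicative structure; junk value `0` when `p = 0`. -/
def mulProd {A : Type*} [Mul A] [Zero A] : (p : ℕ) → (Fin p → A) → A
  | 0, _ => 0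
  | q + 1, φ => Fin.foldl q (fun acc i => acc * φ i.succ) (φ 0)

/-- `p`-th power `a^p` (junk value `0` for `p = 0`). -/
def mpow {A : Type*} [Mul A] [Zero A] (a : A) (p : ℕ) : A :=
  mulProd p (fun _ => a)

/-- The set `Π_p(𝒜)` of all `p`-fold products. -/
def piSet (A : Type*) [Mul A] [Zero A] (p : ℕ) : Set A :=
  {x | ∃ φ : Fin p → A, x = mulProd p φ}

variable {A : Type*} [Lattice A] [AddCommGroup A] [Module ℝ A]

/-- `z` is a majorant of `φ`: `z ≥ 0` and for every `x` there is `c > 0` with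
`|x| ⊓ n • |φ| ≤ c • z` for all `n`. -/
def IsMajorant (z φ : A) : Prop :=
  0 ≤ z ∧ ∀ x : A, ∃ c : ℝ, 0 < c ∧ ∀ n : ℕ, |x| ⊓ n • |φ| ≤ c • z

/-- `φ` is a finite element. -/
def IsFiniteElt (φ : A) : Prop := ∃ z : A, IsMajorant z φ

/-- `φ` is a totally finite element: it has a majorant which is itself finite. -/
def IsTotallyFiniteElt (φ : A) : Prop := ∃ z : A, IsMajorant z φ ∧ IsFiniteElt z

/-- `φ` is self-majorizing: `|φ|` is a majorant of `φ`. -/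
def IsSelfMajorizing (φ : A) : Prop := IsMajorant |φ| φ

/-- `φ ∈ Φ₃(A) = S₊(A) - S₊(A)`. -/
def InPhi3 (φ : A) : Prop :=
  ∃ s t : A, 0 ≤ s ∧ 0 ≤ t ∧ IsSelfMajorizing s ∧ IsSelfMajorizing t ∧ φ = s - t

/-- `w` is a majorant of `φ` relative to the subset `S` (all lattice operations
computed in the ambient algebra). -/
def IsMajorantIn (S : Set A) (w φ : A) : Prop :=
  0 ≤ w ∧ ∀ x ∈ S, ∃ c : ℝ, 0 < c ∧ ∀ n : ℕ, |x| ⊓ n • |φ| ≤ c • w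

/-- `φ` is a finite element of the sublattice `S` (majorant required to lie in `S`). -/
def IsFiniteEltIn (S : Set A) (φ : A) : Prop := ∃ w ∈ S, IsMajorantIn S w φ

/-- `φ` is a totally finite element of the sublattice `S`. -/
def IsTotallyFiniteEltIn (S : Set A) (φ : A) : Prop :=
  ∃ w ∈ S, IsMajorantIn S w φ ∧ IsFiniteEltIn S w

/-- `φ` is self-majorizing in the sublattice `S`. -/
def IsSelfMajorizingIn (S : Set A) (φ : A) : Prop := IsMajorantIn S |φ| φ

/-- `φ ∈ Φ₃(S) = S₊(S) - S₊(S)` for the sublattice `S`. -/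
def InPhi3In (S : Set A) (φ : A) : Prop :=
  ∃ s t : A, s ∈ S ∧ t ∈ S ∧ 0 ≤ s ∧ 0 ≤ t ∧
    IsSelfMajorizingIn S s ∧ IsSelfMajorizingIn S t ∧ φ = s - t

variable (A) in
/-- Archimedean ℓ-algebra structure: an Archimedean vector lattice together with an
associative bilinear multiplication whose product of positive elements is positive. -/
structure IsLAlgebra [Mul A] : Prop where
  add_le_add_left : ∀ a b : A, a ≤ b → ∀ c : A, c + a ≤ c + b
  smul_le_smul : ∀ (r : ℝ) (a b : A), 0 ≤ r → a ≤ b → r • a ≤ r • b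
  archimedean : ∀ a b : A, 0 ≤ a → (∀ n : ℕ, n • a ≤ b) → a = 0
  mul_assoc : ∀ a b c : A, a * b * c = a * (b * c)
  left_distrib : ∀ a b c : A, a * (b + c) = a * b + a * c
  right_distrib : ∀ a b c : A, (a + b) * c = a * c + b * c
  smul_mul : ∀ (r : ℝ) (a b : A), (r • a) * b = r • (a * b)
  mul_smul : ∀ (r : ℝ) (a b : A), a * (r • b) = r • (a * b)
  mul_nonneg : ∀ a b : A, 0 ≤ a → 0 ≤ b → 0 ≤ a * b

variable (A) in
/-- A `d`-algebra: ℓ-algebra in which `a ⊓ b = 0` implies `(a*c) ⊓ (b*c) = (c*a) ⊓ (c*b) = 0`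
for all `c ≥ 0`. -/
structure IsDAlgebra [Mul A] extends IsLAlgebra A : Prop where
  d_prop : ∀ a b c : A, a ⊓ b = 0 → 0 ≤ c → (a * c) ⊓ (b * c) = 0 ∧ (c * a) ⊓ (c * b) = 0

variable (A) in
/-- An `f`-algebra: ℓ-algebra in which `a ⊓ b = 0` implies `(a*c) ⊓ b = (c*a) ⊓ b = 0`
for all `c ≥ 0`. -/
structure IsFAlgebra [Mul A] extends IsLAlgebra A : Prop where
  f_prop : ∀ a b c : A, a ⊓ b = 0 → 0 ≤ c → (a * c) ⊓ b = 0 ∧ (c * a) ⊓ b = 0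

/-- `e` is a multiplicative unit. -/
def IsMulUnit [Mul A] (e : A) : Prop := ∀ a : A, a * e = a ∧ e * a = a

/-- `e` is an order unit. -/
def IsOrderUnit (e : A) : Prop := 0 ≤ e ∧ ∀ x : A, ∃ l : ℝ, 0 ≤ l ∧ |x| ≤ l • e

variable (A) in
/-- The algebra is semiprime: `0` is its only nilpotent element. -/
def IsSemiprime [Mul A] [Zero A] : Prop :=
  ∀ (a : A) (n : ℕ), 0 < n → mpow a n = 0 → a = 0

variable (A) in
/-- The vector lattice is uniformly complete. -/
def UniformlyComplete : Prop :=
  ∀ u : A, 0 ≤ u → ∀ f : ℕ → A,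
    (∀ ε : ℝ, 0 < ε → ∃ K : ℕ, ∀ m n : ℕ, K ≤ m → K ≤ n → |f m - f n| ≤ ε • u) →
    ∃ a : A, ∀ ε : ℝ, 0 < ε → ∃ K : ℕ, ∀ n : ℕ, K ≤ n → |f n - a| ≤ ε • u

variable (A) in
/-- The weak factorization property: every element is dominated by a product. -/
def WeakFactorization [Mul A] : Prop := ∀ a : A, ∃ b c : A, a ≤ b * c


theorem mul_mem_piSet_succ {A : Type*} [Mul A] [Zero A] {q : ℕ} {y : A}
    (hy : y ∈ piSet A (q + 1)) (g : A) : y * g ∈ piSet A (q + 2) := by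
  obtain ⟨φ, rfl⟩ := hy
  refine ⟨Fin.snoc φ g, ?_⟩
  have h0 : (Fin.snoc φ g : Fin (q + 2) → A) 0 = φ 0 := Fin.snoc_castSucc (α := fun _ => A) g φ 0
  have hs : ∀ i : Fin q, (Fin.snoc φ g : Fin (q + 2) → A) i.castSucc.succ = φ i.succ := fun i =>
    Fin.snoc_castSucc (α := fun _ => A) g φ i.succ
  have hl : (Fin.snoc φ g : Fin (q + 2) → A) (Fin.last q).succ = g :=
    Fin.snoc_last (α := fun _ => A) g φ
  simp only [mulProd, Fin.foldl_succ_last, h0, hs, hl]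

theorem IsLAlgebra.isOrderedAddMonoid [Mul A] (hA : IsLAlgebra A) : IsOrderedAddMonoid A where
  add_le_add_left a b h c := by
    simpa only [add_comm] using hA.add_le_add_left a b h c

/-- The ring structure underlying an ℓ-algebra. -/
@[reducible] def IsLAlgebra.nonUnitalRing [Mul A] (hA : IsLAlgebra A) : NonUnitalRing A :=
  { ‹AddCommGroup A›, ‹Mul A› with
    left_distrib := hA.left_distrib
    right_distrib := hA.right_distrib
    mul_assoc := hA.mul_assoc
    zero_mul := fun a => by simpa using hA.right_distrib 0 0 a
    mul_zero := fun a => by simpa using hA.left_distrib a 0 0 }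

theorem IsLAlgebra.mul_le_mul_right_of_nonneg [Mul A] (hA : IsLAlgebra A) {a b c : A}
    (hab : a ≤ b) (hc : 0 ≤ c) : a * c ≤ b * c := by
  let := hA.nonUnitalRing
  have := hA.isOrderedAddMonoid
  rw [← sub_nonneg, ← sub_mul]
  exact hA.mul_nonneg _ _ (sub_nonneg.2 hab) hc

theorem IsLAlgebra.mul_le_abs_mul_abs [Mul A] (hA : IsLAlgebra A) (b c : A) :
    b * c ≤ |b| * |c| := by
  let := hA.nonUnitalRing
  have := hA.isOrderedAddMonoid
  have hsub : ∀ a : A, 0 ≤ |a| - a := fun a => sub_nonneg.2 (le_abs_self a)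
  have hadd : ∀ a : A, 0 ≤ |a| + a := fun a => by
    simpa [sub_nonneg] using sub_nonneg.2 (neg_le_abs a)
  have hsum := add_nonneg (hA.mul_nonneg _ _ (hsub b) (hadd c))
    (hA.mul_nonneg _ _ (hadd b) (hsub c))
  have htwo : (|b| - b) * (|c| + c) + (|b| + b) * (|c| - c)
      = (2 : ℝ) • (|b| * |c| - b * c) := by
    rw [two_smul]
    simp only [sub_mul, add_mul, mul_sub, mul_add]
    abel
  rw [htwo] at hsum
  have hhalf := hA.smul_le_smul (1 / 2) _ _ (by norm_num) hsum
  rw [smul_zero, smul_smul] at hhalf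
  norm_num at hhalf
  exact hhalf

/-- Under weak factorization every element is dominated by a positive `p`-fold product. -/
theorem WeakFactorization.exists_piSet_ge [Mul A] (hwf : WeakFactorization A)
    (hA : IsLAlgebra A) (q : ℕ) (a : A) : ∃ y ∈ piSet A (q + 1), 0 ≤ y ∧ a ≤ y := by
  have := hA.isOrderedAddMonoid
  induction q generalizing a with
  | zero => exact ⟨|a|, ⟨fun _ => |a|, by simp [mulProd]⟩, abs_nonneg a, le_abs_self a⟩
  | succ q ih =>
    obtain ⟨b, c, hbc⟩ := hwf a
    obtain ⟨y, hy, hy0, hby⟩ := ih |b|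
    exact ⟨y * |c|, mul_mem_piSet_succ hy _, hA.mul_nonneg _ _ hy0 (abs_nonneg c),
      (hbc.trans (hA.mul_le_abs_mul_abs b c)).trans
        (hA.mul_le_mul_right_of_nonneg hby (abs_nonneg c))⟩

/-- In a semiprime uniformly complete f-algebra with the weak factorization
property, `Φ₁(Π_p(𝒜)) = Φ₁(𝒜) ∩ Π_p(𝒜)`. -/
theorem stmt17 {A : Type*} [Lattice A] [AddCommGroup A] [Module ℝ A] [Mul A]
    (hA : IsFAlgebra A) (hsp : IsSemiprime A) (huc : UniformlyComplete A)
    (hwf : WeakFactorization A) (p : ℕ) (hp : 2 ≤ p) :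
    ∀ x ∈ piSet A p, (IsFiniteEltIn (piSet A p) x ↔ IsFiniteElt x) := by
  have := hA.toIsLAlgebra.isOrderedAddMonoid
  have hdom : ∀ a : A, ∃ y ∈ piSet A p, 0 ≤ y ∧ a ≤ y := by
    obtain ⟨q, rfl⟩ : ∃ q, p = q + 1 := ⟨p - 1, by omega⟩
    exact hwf.exists_piSet_ge hA.toIsLAlgebra q
  intro x _
  constructor
  · rintro ⟨w, -, hw0, hw⟩
    refine ⟨w, hw0, fun a => ?_⟩
    obtain ⟨y, hy, -, hay⟩ := hdom |a|
    obtain ⟨c, hc, hle⟩ := hw y hy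
    exact ⟨c, hc, fun n => (inf_le_inf_right _ (hay.trans (le_abs_self y))).trans (hle n)⟩
  · rintro ⟨z, -, hz⟩
    obtain ⟨w, hw, hw0, hzw⟩ := hdom z
    refine ⟨w, hw, hw0, fun a _ => ?_⟩
    obtain ⟨c, hc, hle⟩ := hz a
    exact ⟨c, hc, fun n => (hle n).trans (hA.smul_le_smul c _ _ hc.le hzw)⟩

end FiniteElementsPaper
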